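/- Let f be a polynomial map of degree d ≥ 2 over ℂ_p. Then for any point P in the Julia set J(f), J(f) equals the closure (with respect to the chordal metric) of the union over k ≥ 0 of the preimage sets f^{-k}({P}). Moreover, if B ⊆ ℂ_p is a non-empty closed subset satisfying f⁻¹(B) ⊆ B, then J(f) ⊆ B. -/

import Mathlib

open Polynomial

noncomputable section

/-- The projective line over `K`: `K` together with a point at infinity (`none`). -/
def P1 (K : Type*) := Option K

variable {K : Type*}

/-- Inclusion of `K` into the projective line. -/
def toP1 : K → P1 K := some

/-- The point at infinity of the projective line. -/
def P1.infty : P1 K := none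

/-- The extension of a polynomial map to the projective line, sending `∞` to `∞`. -/
def polyMap [CommRing K] (f : K[X]) : P1 K → P1 K :=
  fun z => Option.map (fun w => f.eval w) z

/-- The chordal metric on the projective line over a normed field. -/
def chordal [NormedField K] (x y : P1 K) : ℝ :=
  match x, y with
  | some z, some w => ‖z - w‖ / (max ‖z‖ 1 * max ‖w‖ 1)
  | some z, none => 1 / max ‖z‖ 1
  | none, some w => 1 / max ‖w‖ 1
  | none, none => 0

/-- A subset of the projective line is `ρ`-open if around each of its points it contains a
ball with respect to the chordal metric. -/
def IsRhoOpen [NormedField K] (U : Set (P1 K)) : Prop :=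
  ∀ x ∈ U, ∃ ε > 0, ∀ y, chordal x y < ε → y ∈ U

/-- The topology on the projective line induced by the chordal metric. -/
instance P1.instTopologicalSpace (K : Type*) [NormedField K] : TopologicalSpace (P1 K) where
  IsOpen := IsRhoOpen
  isOpen_univ := fun _ _ => ⟨1, one_pos, fun _ _ => trivial⟩
  isOpen_inter := fun U V hU hV x hx => by
    obtain ⟨ε₁, hε₁, h₁⟩ := hU x hx.1
    obtain ⟨ε₂, hε₂, h₂⟩ := hV x hx.2
    exact ⟨min ε₁ ε₂, lt_min hε₁ hε₂, fun y hy =>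
      ⟨h₁ y (lt_of_lt_of_le hy (min_le_left _ _)), h₂ y (lt_of_lt_of_le hy (min_le_right _ _))⟩⟩
  isOpen_sUnion := fun S hS x hx => by
    obtain ⟨U, hUS, hxU⟩ := hx
    obtain ⟨ε, hε, h⟩ := hS U hUS x hxU
    exact ⟨ε, hε, fun y hy => ⟨U, hUS, h y hy⟩⟩

/-- The Fatou set of a polynomial map: the largest `ρ`-open subset of the projective line on
which the family of iterates is equicontinuous with respect to the chordal metric. -/
def fatou [NormedField K] (f : K[X]) : Set (P1 K) :=
  {x | ∃ U : Set (P1 K), x ∈ U ∧ IsRhoOpen U ∧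
    ∀ y ∈ U, ∀ ε > 0, ∃ δ > 0, ∀ z : P1 K, chordal y z < δ →
      ∀ n : ℕ, chordal ((polyMap f)^[n] y) ((polyMap f)^[n] z) < ε}

/-- The Julia set of a polynomial map: the complement of the Fatou set. -/
def julia [NormedField K] (f : K[X]) : Set (P1 K) :=
  (fatou f)ᶜ

/-- The dynamics of `f` and `g` on their Julia sets are conjugate: there is a homeomorphism
`h : J(f) → J(g)` with `h ∘ f = g ∘ h` on `J(f)`. -/
def JuliaConjugate [NormedField K] (f g : K[X]) : Prop :=
  ∃ h : (julia f) ≃ₜ (julia g),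
    ∀ (z : P1 K) (hz : z ∈ julia f), ∃ hfz : polyMap f z ∈ julia f,
      (h ⟨polyMap f z, hfz⟩ : P1 K) = polyMap g (h ⟨z, hz⟩)

/-- `min {|l|^{1/(l-1)} : 2 ≤ l ≤ d}` where `|l|` is the `p`-adic absolute value of `l`. -/
def muFactor (p : ℕ) [Fact (Nat.Prime p)] (d : ℕ) : ℝ :=
  sInf {x : ℝ | ∃ l : ℕ, 2 ≤ l ∧ l ≤ d ∧ x = ‖(l : ℚ_[p])‖ ^ ((1 : ℝ) / ((l : ℝ) - 1))}

theorem norm_sub_le_max_norm [NormedField K] [IsUltrametricDist K] (x y : K) :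
    ‖x - y‖ ≤ max ‖x‖ ‖y‖ := by
  simpa [sub_eq_add_neg] using IsUltrametricDist.norm_add_le_max x (-y)

theorem norm_prod_sub_prod_le [NormedField K] [IsUltrametricDist K] {c z : K} {r : ℝ} (hr : 0 < r)
    (hz : ‖z - c‖ ≤ r) (s : Multiset K) (hs : ∀ a ∈ s, r ≤ ‖c - a‖) :
    ‖(s.map (fun a => z - a)).prod - (s.map (fun a => c - a)).prod‖ ≤
      ‖z - c‖ / r * ‖(s.map (fun a => c - a)).prod‖ := by
  induction s using Multiset.induction_on with
  | empty => simp; positivity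
  | cons a s ih =>
    have ih := ih fun b hb => hs b (Multiset.mem_cons_of_mem hb)
    have ha := hs a (Multiset.mem_cons_self a s)
    simp only [Multiset.map_cons, Multiset.prod_cons]
    set B := (s.map (fun a => z - a)).prod
    set B' := (s.map (fun a => c - a)).prod
    have ht : ‖z - c‖ / r ≤ 1 := (div_le_one hr).2 hz
    have hBB : ‖B - B'‖ ≤ ‖B'‖ :=
      ih.trans (mul_le_of_le_one_left (norm_nonneg _) ht)
    have hB : ‖B‖ ≤ ‖B'‖ := by
      calc ‖B‖ = ‖(B - B') + B'‖ := by rw [sub_add_cancel]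
        _ ≤ max ‖B - B'‖ ‖B'‖ := IsUltrametricDist.norm_add_le_max _ _
        _ ≤ ‖B'‖ := max_le hBB le_rfl
    have e : (z - a) * B - (c - a) * B' = (z - c) * B + (c - a) * (B - B') := by ring
    rw [e, norm_mul]
    refine (IsUltrametricDist.norm_add_le_max _ _).trans (max_le ?_ ?_)
    · rw [norm_mul]
      calc ‖z - c‖ * ‖B‖ = ‖z - c‖ / r * (r * ‖B‖) := by field_simp
        _ ≤ ‖z - c‖ / r * (‖c - a‖ * ‖B'‖) := by gcongr
    · rw [norm_mul]
      calc ‖c - a‖ * ‖B - B'‖ ≤ ‖c - a‖ * (‖z - c‖ / r * ‖B'‖) := by gcongr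
        _ = _ := by ring

theorem norm_eval_sub_eval_le [NormedField K] [IsUltrametricDist K] [IsAlgClosed K] {c z : K}
    {r : ℝ} (hr : 0 < r) (F : K[X]) (hF : ∀ w, ‖w - c‖ < r → F.eval w ≠ 0) (hz : ‖z - c‖ ≤ r) :
    ‖F.eval z - F.eval c‖ ≤ ‖z - c‖ / r * ‖F.eval c‖ := by
  have hs := IsAlgClosed.splits F
  rw [hs.eval_eq_prod_roots z, hs.eval_eq_prod_roots c, ← mul_sub, norm_mul, norm_mul]
  have h := norm_prod_sub_prod_le hr hz F.roots fun a ha => by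
    by_contra! h
    exact hF a (by rwa [norm_sub_rev]) (isRoot_of_mem_roots ha)
  calc _ ≤ ‖F.leadingCoeff‖ * (‖z - c‖ / r * ‖(F.roots.map (fun a => c - a)).prod‖) := by gcongr
    _ = _ := by ring

theorem chordal_toP1 [NormedField K] (z w : K) :
    chordal (toP1 z) (toP1 w) = ‖z - w‖ / (max ‖z‖ 1 * max ‖w‖ 1) := rfl

theorem chordal_toP1_le [NormedField K] (z w : K) : chordal (toP1 z) (toP1 w) ≤ ‖z - w‖ := by
  rw [chordal_toP1]
  exact div_le_self (norm_nonneg _) (one_le_mul_of_one_le_of_one_le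
    (le_max_right _ _) (le_max_right _ _))

theorem exists_toP1_of_chordal_lt [NormedField K] [IsUltrametricDist K] (y : K) {r : ℝ}
    (hr : 0 < r) :
    ∃ ε > 0, ∀ x : P1 K, chordal (toP1 y) x < ε → ∃ w, x = toP1 w ∧ ‖y - w‖ < r := by
  set M := max ‖y‖ 1 with hM
  have hM1 : 1 ≤ M := le_max_right _ _
  have hM0 : 0 < M := by linarith
  refine ⟨min (1 / M) (r / (M * M)), by positivity, fun x hx => ?_⟩
  match x, hx with
  | none, hx =>
    exact absurd (hx.trans_le (min_le_left _ _)) (lt_irrefl (1 / M))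
  | some w, hx =>
    refine ⟨w, rfl, ?_⟩
    change ‖y - w‖ / (M * max ‖w‖ 1) < _ at hx
    obtain ⟨h1, h2⟩ := lt_min_iff.1 hx
    have hw : max ‖w‖ 1 ≤ M := by
      by_contra! h
      have hlt : M < ‖w‖ := (lt_max_iff.1 h).resolve_right hM1.not_gt
      have hne : ‖y‖ < ‖w‖ := (le_max_left _ _).trans_lt hlt
      have e : ‖y - w‖ = ‖w‖ := by
        rw [sub_eq_add_neg, IsUltrametricDist.norm_add_eq_max_of_norm_ne_norm (by simpa using hne.ne),
          norm_neg, max_eq_right hne.le]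
      have hw0 : 0 < ‖w‖ := hM0.trans hlt
      rw [e, max_eq_left (hM1.trans hlt.le)] at h1
      have : ‖w‖ / (M * ‖w‖) = 1 / M := by field_simp
      exact absurd h1 this.not_lt
    rw [div_lt_div_iff₀ (by positivity) (by positivity)] at h2
    have : ‖y - w‖ * (M * M) < r * (M * M) := h2.trans_le (by gcongr)
    exact lt_of_mul_lt_mul_right this (by positivity)

theorem polyMap_iterate_toP1 [CommRing K] (f : K[X]) (n : ℕ) (z : K) :
    (polyMap f)^[n] (toP1 z) = toP1 ((f.comp^[n] X).eval z) := by
  rw [iterate_comp_eval, eval_X]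
  exact ((Function.Semiconj.iterate_right (f := toP1) (ga := fun x => f.eval x)
    (gb := polyMap f) (fun _ => rfl) n) z).symm

theorem polyMap_iterate_infty [CommRing K] (f : K[X]) (n : ℕ) :
    (polyMap f)^[n] P1.infty = P1.infty :=
  Function.iterate_fixed (f := polyMap f) (x := P1.infty) rfl n

/-- Equicontinuity of the iterates of `f` at the point `y`. -/
def EquicontinuousIteratesAt [NormedField K] (f : K[X]) (y : P1 K) : Prop :=
  ∀ ε > 0, ∃ δ > 0, ∀ z : P1 K, chordal y z < δ →
    ∀ n : ℕ, chordal ((polyMap f)^[n] y) ((polyMap f)^[n] z) < ε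

/-- A non-archimedean Montel theorem for iterates of a polynomial: omitting one finite value on a
ball forces equicontinuity at its centre. -/
theorem equicontinuousIteratesAt_of_omits [NormedField K] [IsUltrametricDist K] [IsAlgClosed K]
    (f : K[X]) (a c : K) {r : ℝ} (hr : 0 < r)
    (h : ∀ w, ‖w - c‖ < r → ∀ n : ℕ, (polyMap f)^[n] (toP1 w) ≠ toP1 a) :
    EquicontinuousIteratesAt f (toP1 c) := by
  intro ε hε
  set A := max ‖a‖ 1 with hA
  have hA1 : 1 ≤ A := le_max_right _ _
  obtain ⟨δ, hδ, H⟩ := exists_toP1_of_chordal_lt c (r := min r (ε * r / A)) (by positivity)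
  refine ⟨δ, hδ, fun x hx n => ?_⟩
  obtain ⟨z, rfl, hz⟩ := H x hx
  obtain ⟨h1, h2⟩ := lt_min_iff.1 hz
  rw [norm_sub_rev] at h1 h2
  set F := f.comp^[n] X with hF
  have key := norm_eval_sub_eval_le hr (F - C a) (fun w hw h0 => h w hw n <| by
    rw [polyMap_iterate_toP1, ← hF, sub_eq_zero.1 (by simpa using h0 : F.eval w - a = 0)]) h1.le
  simp only [eval_sub, eval_C, sub_sub_sub_cancel_right] at key
  rw [polyMap_iterate_toP1, polyMap_iterate_toP1, chordal_toP1, norm_sub_rev, ← hF]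
  set u := F.eval c
  set v := F.eval z
  have hu : ‖u - a‖ ≤ max ‖u‖ 1 * A := by
    refine (norm_sub_le_max_norm _ _).trans (max_le ?_ ?_)
    · exact (le_max_left _ _).trans (le_mul_of_one_le_right (by positivity) hA1)
    · exact (le_max_left _ _).trans (le_mul_of_one_le_left (by positivity) (le_max_right _ _))
  have hv : (1 : ℝ) ≤ max ‖v‖ 1 := le_max_right _ _
  have ht : ‖z - c‖ / r * A < ε := by
    rw [lt_div_iff₀ (by positivity)] at h2
    rw [div_mul_eq_mul_div, div_lt_iff₀ hr]
    exact h2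
  rw [div_lt_iff₀ (by positivity)]
  calc ‖v - u‖ ≤ ‖z - c‖ / r * (max ‖u‖ 1 * A) := key.trans (by gcongr)
    _ = ‖z - c‖ / r * A * max ‖u‖ 1 := by ring
    _ < ε * max ‖u‖ 1 := by gcongr
    _ ≤ ε * (max ‖u‖ 1 * max ‖v‖ 1) := by
      gcongr
      exact le_mul_of_one_le_right (by positivity) hv

theorem toP1_mem_fatou_of_omits [NormedField K] [IsUltrametricDist K] [IsAlgClosed K]
    (f : K[X]) (a c : K) {r : ℝ} (hr : 0 < r)
    (h : ∀ w, ‖w - c‖ < r → ∀ n : ℕ, (polyMap f)^[n] (toP1 w) ≠ toP1 a) :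
    toP1 c ∈ fatou f := by
  have hball : ∀ y w : K, ‖y - c‖ < r → ‖w - y‖ < r → ‖w - c‖ < r := fun y w hy hw => by
    rw [← sub_add_sub_cancel w y c]
    exact (IsUltrametricDist.norm_add_le_max _ _).trans_lt (max_lt hw hy)
  refine ⟨toP1 '' {w | ‖w - c‖ < r}, ⟨c, by simpa using hr, rfl⟩, ?_, ?_⟩
  · rintro _ ⟨y, hy, rfl⟩
    obtain ⟨ε, hε, H⟩ := exists_toP1_of_chordal_lt y hr
    refine ⟨ε, hε, fun x hx => ?_⟩
    obtain ⟨w, rfl, hw⟩ := H x hx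
    exact ⟨w, hball y w hy (by rwa [norm_sub_rev]), rfl⟩
  · rintro _ ⟨y, hy, rfl⟩
    exact equicontinuousIteratesAt_of_omits f a y hr fun w hw => h w (hball y w hy hw)

theorem exists_norm_le_norm_eval [NormedField K] (f : K[X]) (hf : 2 ≤ f.natDegree) :
    ∃ R : ℝ, 1 ≤ R ∧ ∀ z : K, R < ‖z‖ → ‖z‖ ≤ ‖f.eval z‖ := by
  have hdeg : 0 < f.divX.degree := by
    rw [← natDegree_pos_iff_degree_pos, natDegree_divX_eq_natDegree_tsub_one]
    omega
  have ht := f.divX.tendsto_norm_atTop hdeg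
    (Filter.tendsto_comap : Filter.Tendsto (fun z : K => ‖z‖) (Filter.comap _ Filter.atTop) _)
  have h2 := ht.eventually_ge_atTop 2
  rw [Filter.eventually_comap] at h2
  obtain ⟨R, hR⟩ := Filter.eventually_atTop.1 h2
  refine ⟨max R (max ‖f.coeff 0‖ 1), (le_max_right _ _).trans (le_max_right _ _), fun z hz => ?_⟩
  have hz1 : R ≤ ‖z‖ := (le_max_left _ _).trans hz.le
  have hz2 : ‖f.coeff 0‖ ≤ ‖z‖ := ((le_max_left _ _).trans (le_max_right _ _)).trans hz.le
  have hg := hR _ hz1 z rfl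
  have e : f.eval z = f.divX.eval z * z + f.coeff 0 := by
    conv_lhs => rw [← divX_mul_X_add f]
    simp
  have h3 : ‖f.divX.eval z * z‖ ≤ ‖f.eval z‖ + ‖f.coeff 0‖ := by
    have : f.divX.eval z * z = f.eval z - f.coeff 0 := by rw [e]; ring
    rw [this]
    exact norm_sub_le _ _
  rw [norm_mul] at h3
  nlinarith [norm_nonneg z]

theorem infty_mem_fatou [NormedField K] [IsUltrametricDist K] [IsAlgClosed K]
    (f : K[X]) (hf : 2 ≤ f.natDegree) : P1.infty ∈ fatou f := by
  obtain ⟨R, hR1, hR⟩ := exists_norm_le_norm_eval f hf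
  have hit : ∀ (n : ℕ) (z : K), R < ‖z‖ → ‖z‖ ≤ ‖(f.comp^[n] X).eval z‖ := by
    intro n z hz
    rw [iterate_comp_eval, eval_X]
    induction n with
    | zero => exact le_rfl
    | succ n ih =>
      rw [Function.iterate_succ_apply']
      exact ih.trans (hR _ (hz.trans_le ih))
  have hball : ∀ y w : K, R < ‖y‖ → ‖w - y‖ < ‖y‖ → R < ‖w‖ := fun y w hy hw => by
    have h1 : ‖y‖ ≤ max ‖w‖ ‖w - y‖ := by
      simpa using norm_sub_le_max_norm w (w - y)
    rcases le_max_iff.1 h1 with h | h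
    · exact hy.trans_le h
    · exact absurd hw h.not_gt
  have hnear : ∀ ε > 0, ∀ z : K, chordal P1.infty (toP1 z) < min ε (1 / R) →
      R < ‖z‖ ∧ 1 / ‖z‖ < ε := by
    intro ε hε z hz
    change 1 / max ‖z‖ 1 < _ at hz
    obtain ⟨h1, h2⟩ := lt_min_iff.1 hz
    have h3 : R < max ‖z‖ 1 := (one_div_lt_one_div (by positivity) (by positivity)).1 h2
    have h4 : R < ‖z‖ := (lt_max_iff.1 h3).resolve_right hR1.not_gt
    rw [max_eq_left (hR1.trans h4.le)] at h1
    exact ⟨h4, h1⟩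
  refine ⟨insert P1.infty (toP1 '' {z | R < ‖z‖}), Set.mem_insert _ _, ?_, ?_⟩
  · rintro _ (rfl | ⟨y, hy, rfl⟩)
    · refine ⟨min 1 (1 / R), by positivity, fun x hx => ?_⟩
      match x, hx with
      | none, _ => exact Set.mem_insert _ _
      | some z, hx => exact Or.inr ⟨z, (hnear 1 one_pos z hx).1, rfl⟩
    · obtain ⟨ε, hε, H⟩ := exists_toP1_of_chordal_lt y (r := ‖y‖) (by linarith [show R < ‖y‖ from hy])
      refine ⟨ε, hε, fun x hx => ?_⟩
      obtain ⟨w, rfl, hw⟩ := H x hx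
      exact Or.inr ⟨w, hball y w hy (by rwa [norm_sub_rev]), rfl⟩
  · rintro _ (rfl | ⟨y, hy, rfl⟩)
    · intro ε hε
      refine ⟨min ε (1 / R), by positivity, fun x hx n => ?_⟩
      rw [polyMap_iterate_infty]
      match x, hx with
      | none, _ =>
        change chordal _ ((polyMap f)^[n] P1.infty) < ε
        rw [polyMap_iterate_infty]
        exact hε
      | some z, hx =>
        obtain ⟨h1, h2⟩ := hnear ε hε z hx
        change chordal _ ((polyMap f)^[n] (toP1 z)) < ε
        rw [polyMap_iterate_toP1]
        change 1 / max ‖(f.comp^[n] X).eval z‖ 1 < ε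
        have h0 : 0 < ‖z‖ := by linarith
        refine lt_of_le_of_lt ?_ h2
        exact one_div_le_one_div_of_le h0 ((hit n z h1).trans (le_max_left _ _))
    · have hy : R < ‖y‖ := hy
      refine equicontinuousIteratesAt_of_omits f 0 y (r := ‖y‖) (by linarith) fun w hw n h => ?_
      rw [polyMap_iterate_toP1] at h
      have hw' := hball y w hy hw
      have h1 := hit n w hw'
      rw [Option.some.inj h, norm_zero] at h1
      linarith

theorem isOpen_fatou [NormedField K] (f : K[X]) : IsOpen (fatou f) := by
  rintro x ⟨U, hxU, hU, hE⟩
  obtain ⟨ε, hε, h⟩ := hU x hxU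
  exact ⟨ε, hε, fun y hy => ⟨U, h y hy, hU, hE⟩⟩

/-- A nonconstant polynomial over an algebraically closed normed field is an open map. -/
theorem exists_eval_eq_of_norm_lt [NormedField K] [IsAlgClosed K] (f : K[X])
    (hf : 0 < f.natDegree) (y : K) {r : ℝ} (hr : 0 < r) :
    ∃ δ > 0, ∀ w : K, ‖f.eval y - w‖ < δ → ∃ z, ‖y - z‖ < r ∧ f.eval z = w := by
  have hlc : 0 < ‖f.leadingCoeff‖ := by
    rw [norm_pos_iff, leadingCoeff_ne_zero]
    rintro rfl
    simp at hf
  refine ⟨‖f.leadingCoeff‖ * r ^ f.natDegree, by positivity, fun w hw => ?_⟩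
  by_contra! H
  have hs := IsAlgClosed.splits (f - C w)
  have he := hs.eval_eq_prod_roots y
  have hd : (f - C w).natDegree = f.natDegree := natDegree_sub_C
  have hl : (f - C w).leadingCoeff = f.leadingCoeff :=
    leadingCoeff_sub_of_degree_lt (degree_C_le.trans_lt (natDegree_pos_iff_degree_pos.1 hf))
  have hcard : (f - C w).roots.card = f.natDegree := by rw [← hd, hs.natDegree_eq_card_roots]
  have hroot : ∀ a ∈ (f - C w).roots, r ≤ ‖y - a‖ := fun a ha => by
    by_contra! h
    exact H a h (sub_eq_zero.1 (by simpa using isRoot_of_mem_roots ha))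
  have hprod : ∀ s : Multiset K, (∀ a ∈ s, r ≤ ‖y - a‖) →
      r ^ s.card ≤ ‖(s.map (fun a => y - a)).prod‖ := by
    intro s
    induction s using Multiset.induction_on with
    | empty => simp
    | cons a s ih =>
      intro h
      rw [Multiset.card_cons, pow_succ', Multiset.map_cons, Multiset.prod_cons, norm_mul]
      exact mul_le_mul (h a (Multiset.mem_cons_self a s))
        (ih fun b hb => h b (Multiset.mem_cons_of_mem hb)) (by positivity) (norm_nonneg _)
  have h1 := hprod _ hroot
  rw [eval_sub, eval_C, hl] at he
  rw [he, norm_mul, ← hcard] at hw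
  exact absurd hw (not_lt.2 (by gcongr))

theorem polyMap_mem_fatou [NormedField K] [IsUltrametricDist K] [IsAlgClosed K] (f : K[X])
    (hf : 0 < f.natDegree) {x : P1 K} (hx : x ∈ fatou f) : polyMap f x ∈ fatou f := by
  match x, hx with
  | none, hx => exact hx
  | some y, ⟨U, hyU, hU, hE⟩ =>
    have hlift : ∀ z : K, ∀ ε > 0, ∃ δ > 0, ∀ x : P1 K, chordal (toP1 (f.eval z)) x < δ →
        ∃ z', chordal (toP1 z) (toP1 z') < ε ∧ x = toP1 (f.eval z') := by
      intro z ε hε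
      obtain ⟨r, hr, h1⟩ := exists_eval_eq_of_norm_lt f hf z hε
      obtain ⟨δ, hδ, h2⟩ := exists_toP1_of_chordal_lt (f.eval z) hr
      refine ⟨δ, hδ, fun x hx => ?_⟩
      obtain ⟨w, rfl, hw⟩ := h2 x hx
      obtain ⟨z', hz', rfl⟩ := h1 w hw
      exact ⟨z', (chordal_toP1_le _ _).trans_lt hz', rfl⟩
    refine ⟨{x | ∃ z, toP1 z ∈ U ∧ x = toP1 (f.eval z)}, ⟨y, hyU, rfl⟩, ?_, ?_⟩
    · rintro _ ⟨z, hz, rfl⟩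
      obtain ⟨ε, hε, h⟩ := hU _ hz
      obtain ⟨δ, hδ, h2⟩ := hlift z ε hε
      refine ⟨δ, hδ, fun x hx => ?_⟩
      obtain ⟨z', hz', rfl⟩ := h2 x hx
      exact ⟨z', h _ hz', rfl⟩
    · rintro _ ⟨z, hz, rfl⟩ ε hε
      obtain ⟨η, hη, h⟩ := hE _ hz ε hε
      obtain ⟨δ, hδ, h2⟩ := hlift z η hη
      refine ⟨δ, hδ, fun x hx n => ?_⟩
      obtain ⟨z', hz', rfl⟩ := h2 x hx
      exact h _ hz' (n + 1)

theorem exists_toP1_of_mem_julia [NormedField K] [IsUltrametricDist K] [IsAlgClosed K]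
    (f : K[X]) (hf : 2 ≤ f.natDegree) {x : P1 K} (hx : x ∈ julia f) : ∃ c, x = toP1 c := by
  match x, hx with
  | none, hx => exact absurd (infty_mem_fatou f hf) hx
  | some c, _ => exact ⟨c, rfl⟩

theorem exists_iterate_eq_of_mem_julia [NormedField K] [IsUltrametricDist K] [IsAlgClosed K]
    (f : K[X]) (a : K) {c : K} (hc : toP1 c ∈ julia f) {r : ℝ} (hr : 0 < r) :
    ∃ w, ‖w - c‖ < r ∧ ∃ n : ℕ, (polyMap f)^[n] (toP1 w) = toP1 a := by
  by_contra! H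
  exact hc (toP1_mem_fatou_of_omits f a c hr H)

/-- **Theorem 2.3 (consequences of Hsia's Montel theorem).** For a polynomial map `f` of
degree `d ≥ 2` over `ℂ_p`, the Julia set equals the closure of the backward orbit of any of
its points and is contained in every non-empty closed backward-invariant subset of `ℂ_p`. -/
theorem julia_eq_closure_backward_orbit_and_subset_invariant
    {p : ℕ} [Fact (Nat.Prime p)] {K : Type*} [NormedField K] [IsAlgClosed K]
    [CompleteSpace K] [IsUltrametricDist K] [Algebra ℚ_[p] K]
    (hext : ∀ q : ℚ_[p], ‖algebraMap ℚ_[p] K q‖ = ‖q‖)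
    (d : ℕ) (hd : 2 ≤ d) (f : K[X]) (hdeg : f.natDegree = d) :
    (∀ P ∈ julia f, julia f = closure (⋃ k : ℕ, (polyMap f)^[k] ⁻¹' {P})) ∧
    (∀ B : Set K, B.Nonempty → IsClosed B → (fun z => f.eval z) ⁻¹' B ⊆ B →
      julia f ⊆ toP1 '' B) := by
  subst hdeg
  refine ⟨fun P hP => Set.Subset.antisymm ?_ ?_, fun B hB hBc hBinv x hx => ?_⟩
  · intro x hx
    obtain ⟨c, rfl⟩ := exists_toP1_of_mem_julia f hd hx
    obtain ⟨a, rfl⟩ := exists_toP1_of_mem_julia f hd hP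
    rw [mem_closure_iff]
    intro O hO hcO
    obtain ⟨ε, hε, h⟩ := hO _ hcO
    obtain ⟨w, hw, n, hn⟩ := exists_iterate_eq_of_mem_julia f a hx hε
    refine ⟨toP1 w, h _ ((chordal_toP1_le _ _).trans_lt (by rwa [norm_sub_rev])), ?_⟩
    exact Set.mem_iUnion.2 ⟨n, hn⟩
  · refine closure_minimal (Set.iUnion_subset fun k x hx => ?_) (isOpen_fatou f).isClosed_compl
    intro hxF
    have hit : (polyMap f)^[k] x ∈ fatou f := by
      clear hx
      induction k with
      | zero => exact hxF
      | succ k ih =>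
        rw [Function.iterate_succ_apply']
        exact polyMap_mem_fatou f (by omega) ih
    rw [Set.mem_singleton_iff.1 hx] at hit
    exact hP hit
  · obtain ⟨c, rfl⟩ := exists_toP1_of_mem_julia f hd hx
    obtain ⟨b, hb⟩ := hB
    refine ⟨c, ?_, rfl⟩
    rw [← hBc.closure_eq, Metric.mem_closure_iff]
    intro ε hε
    obtain ⟨w, hw, n, hn⟩ := exists_iterate_eq_of_mem_julia f b hx hε
    refine ⟨w, ?_, by rwa [dist_comm, dist_eq_norm]⟩
    rw [polyMap_iterate_toP1, iterate_comp_eval, eval_X] at hn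
    have hwb : (fun z => f.eval z)^[n] w = b := Option.some.inj hn
    clear hn hw
    induction n generalizing w with
    | zero => exact (show w = b from hwb) ▸ hb
    | succ n ih => exact hBinv (ih (f.eval w) hwb)
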